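/- arXiv:2101.11525 — 5 statements merged into one kernel-verified Lean document; each statement's English description precedes it below -/
import Mathlib

section
/- For every real τ with 0 < τ ≤ 1 and every real constant c, the function h(x) = √((x + τ/(1+e^x))² + c²) − √(x² + c²) is strictly decreasing on the interval [3/2, ∞). -/
theorem div_one_add_exp_antitoneOn :
    AntitoneOn (fun x : ℝ => x / (1 + Real.exp x)) (Set.Ici (3 / 2 : ℝ)) := by
  intro x hx y _ hxy
  have hx : 3 / 2 ≤ x := hx
  have hex := Real.exp_pos x
  have hey := Real.exp_pos y
  have hexp := Real.add_one_le_exp x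
  have hmul : Real.exp x * (y - x + 1) ≤ Real.exp y := by
    calc Real.exp x * (y - x + 1) ≤ Real.exp x * Real.exp (y - x) :=
          mul_le_mul_of_nonneg_left (Real.add_one_le_exp _) hex.le
      _ = Real.exp y := by rw [← Real.exp_add]; ring_nf
  have hone : 1 ≤ (x - 1) * Real.exp x := by nlinarith
  have hscaled := mul_le_mul_of_nonneg_left hmul (show 0 ≤ x by linarith)
  have hgap := mul_le_mul_of_nonneg_left hone (sub_nonneg.2 hxy)
  change y / (1 + Real.exp y) ≤ x / (1 + Real.exp x)
  rw [div_le_div_iff₀ (by positivity) (by positivity)]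
  linarith

theorem sub_lt_sub_of_sq_sub_sq_le {A B X Y : ℝ} (hX : 0 ≤ X) (hXY : X < Y) (hXA : X < A)
    (hYB : Y < B) (h : B ^ 2 - A ^ 2 ≤ Y ^ 2 - X ^ 2) : B - A < Y - X := by
  by_contra! hle
  have hsum : 0 < B + A := by linarith
  have hsq := mul_le_mul_of_nonneg_right hle hsum.le
  have hlt := mul_lt_mul_of_pos_left (show Y + X < B + A by linarith) (sub_pos.2 hXY)
  linarith

/-- For every real τ with 0 < τ ≤ 1 and every real constant c, the function
h(x) = √((x + τ/(1+e^x))² + c²) − √(x² + c²) is strictly decreasing on [3/2, ∞). -/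
theorem contrast_reg_h_strictAntiOn (τ c : ℝ) (hτ0 : 0 < τ) (hτ1 : τ ≤ 1) :
    StrictAntiOn
      (fun x : ℝ =>
        Real.sqrt ((x + τ / (1 + Real.exp x)) ^ 2 + c ^ 2) - Real.sqrt (x ^ 2 + c ^ 2))
      (Set.Ici (3 / 2 : ℝ)) := by
  intro x hx y hy hxy
  have hprod : y / (1 + Real.exp y) ≤ x / (1 + Real.exp x) :=
    div_one_add_exp_antitoneOn hx hy hxy.le
  have hx : 3 / 2 ≤ x := hx
  have hshift : τ / (1 + Real.exp y) ≤ τ / (1 + Real.exp x) := by gcongr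
  have hmul : y * (τ / (1 + Real.exp y)) ≤ x * (τ / (1 + Real.exp x)) := by
    calc y * (τ / (1 + Real.exp y)) = τ * (y / (1 + Real.exp y)) := by ring
      _ ≤ τ * (x / (1 + Real.exp x)) := mul_le_mul_of_nonneg_left hprod hτ0.le
      _ = x * (τ / (1 + Real.exp x)) := by ring
  have hδx : 0 < τ / (1 + Real.exp x) := by positivity
  have hδy : 0 < τ / (1 + Real.exp y) := by positivity
  have hsq := pow_le_pow_left₀ hδy.le hshift 2
  have hsqrt {s t : ℝ} (hs : 0 ≤ s) (hst : s < t) : √(s ^ 2 + c ^ 2) < √(t ^ 2 + c ^ 2) :=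
    Real.sqrt_lt_sqrt (by positivity) (by gcongr)
  have hmain := sub_lt_sub_of_sq_sub_sq_le (Real.sqrt_nonneg (x ^ 2 + c ^ 2))
    (hsqrt (by linarith) hxy)
    (hsqrt (by linarith) (lt_add_of_pos_right x hδx))
    (hsqrt (by linarith) (lt_add_of_pos_right y hδy))
    (by
      rw [Real.sq_sqrt (by positivity), Real.sq_sqrt (by positivity),
        Real.sq_sqrt (by positivity), Real.sq_sqrt (by positivity)]
      linarith)
  change √((y + τ / (1 + Real.exp y)) ^ 2 + c ^ 2) - √(y ^ 2 + c ^ 2) <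
    √((x + τ / (1 + Real.exp x)) ^ 2 + c ^ 2) - √(x ^ 2 + c ^ 2)
  linarith
end

section
/- For every real τ with 0 < τ ≤ 1, every real constant c, and all reals x > y ≥ 3/2, we have 0 < √((x + τ/(1+e^x))² + c²) − √((y + τ/(1+e^y))² + c²) < √(x² + c²) − √(y² + c²). -/
/-- The map `t ↦ t / (1 + e^t)` is antitone on `[3/2, ∞)`. -/
lemma mul_one_div_one_add_exp_le {x y : ℝ} (hy : 3 / 2 ≤ y) (hxy : y < x) :
    x * (1 / (1 + Real.exp x)) ≤ y * (1 / (1 + Real.exp y)) := by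
  have hey : y + 1 ≤ Real.exp y := Real.add_one_le_exp y
  have hd : x - y + 1 ≤ Real.exp (x - y) := Real.add_one_le_exp (x - y)
  have hex : Real.exp x = Real.exp y * Real.exp (x - y) := by
    rw [← Real.exp_add]; ring_nf
  have hmul : y * Real.exp y * (x - y + 1) ≤ y * Real.exp x := by
    rw [hex, ← mul_assoc]
    exact mul_le_mul_of_nonneg_left hd (by positivity)
  have hone : 1 ≤ (y - 1) * Real.exp y := by nlinarith
  rw [mul_one_div, mul_one_div, div_le_div_iff₀ (by positivity) (by positivity)]
  nlinarith [mul_le_mul_of_nonneg_left hone (sub_pos.2 hxy).le]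

/-- The map `t ↦ t + 1 / (1 + e^t)` is strictly increasing. -/
lemma one_div_one_add_exp_sub_lt {x y : ℝ} (hxy : y < x) :
    1 / (1 + Real.exp y) - 1 / (1 + Real.exp x) < x - y := by
  have hd : y - x + 1 ≤ Real.exp (y - x) := Real.add_one_le_exp (y - x)
  have hey : Real.exp y = Real.exp x * Real.exp (y - x) := by
    rw [← Real.exp_add]; ring_nf
  have hx := Real.exp_pos x
  have hy := Real.exp_pos y
  have hmul : Real.exp x * (y - x + 1) ≤ Real.exp y := by
    rw [hey]
    exact mul_le_mul_of_nonneg_left hd hx.le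
  rw [div_sub_div _ _ (by positivity) (by positivity), div_lt_iff₀ (by positivity)]
  have hxy' := sub_pos.2 hxy
  nlinarith [mul_pos hxy' hy, mul_pos hxy' (mul_pos hx hy)]

/-- Moving `x` and `y` to larger `a` and `b` shrinks the gap `√(x² + k) - √(y² + k)` as long as
the gap between the squares does not grow. -/
lemma sqrt_sq_add_sub_lt {a b x y k : ℝ} (hk : 0 ≤ k) (hy : 0 < y) (hx : 0 < x)
    (hba : b < a) (hyb : y < b) (hxa : x < a) (hsq : a ^ 2 - b ^ 2 ≤ x ^ 2 - y ^ 2) :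
    √(a ^ 2 + k) - √(b ^ 2 + k) < √(x ^ 2 + k) - √(y ^ 2 + k) := by
  have hA := Real.sq_sqrt (show 0 ≤ a ^ 2 + k by positivity)
  have hB := Real.sq_sqrt (show 0 ≤ b ^ 2 + k by positivity)
  have hX := Real.sq_sqrt (show 0 ≤ x ^ 2 + k by positivity)
  have hY := Real.sq_sqrt (show 0 ≤ y ^ 2 + k by positivity)
  have hXA : √(x ^ 2 + k) < √(a ^ 2 + k) :=
    Real.sqrt_lt_sqrt (by positivity) (by nlinarith)
  have hYB : √(y ^ 2 + k) < √(b ^ 2 + k) :=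
    Real.sqrt_lt_sqrt (by positivity) (by nlinarith)
  have hBA : √(b ^ 2 + k) < √(a ^ 2 + k) :=
    Real.sqrt_lt_sqrt (by positivity) (by nlinarith)
  have hX0 : 0 < √(x ^ 2 + k) := Real.sqrt_pos.2 (by positivity)
  have hY0 : 0 < √(y ^ 2 + k) := Real.sqrt_pos.2 (by positivity)
  generalize √(a ^ 2 + k) = A at *
  generalize √(b ^ 2 + k) = B at *
  generalize √(x ^ 2 + k) = X at *
  generalize √(y ^ 2 + k) = Y at *
  have hlt : (A - B) * (X + Y) < (A - B) * (A + B) :=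
    mul_lt_mul_of_pos_left (by linarith) (by linarith)
  refine lt_of_mul_lt_mul_right (a := X + Y) ?_ (by linarith)
  nlinarith


/-- For every real τ with 0 < τ ≤ 1, every real constant c, and all reals x > y ≥ 3/2,
0 < √((x + τ/(1+e^x))² + c²) − √((y + τ/(1+e^y))² + c²) < √(x² + c²) − √(y² + c²). -/
theorem contrast_reg_norm_gap_contraction (τ c x y : ℝ) (hτ0 : 0 < τ) (hτ1 : τ ≤ 1)
    (hy : 3 / 2 ≤ y) (hxy : y < x) :
    0 < Real.sqrt ((x + τ / (1 + Real.exp x)) ^ 2 + c ^ 2)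
          - Real.sqrt ((y + τ / (1 + Real.exp y)) ^ 2 + c ^ 2) ∧
    Real.sqrt ((x + τ / (1 + Real.exp x)) ^ 2 + c ^ 2)
          - Real.sqrt ((y + τ / (1 + Real.exp y)) ^ 2 + c ^ 2)
        < Real.sqrt (x ^ 2 + c ^ 2) - Real.sqrt (y ^ 2 + c ^ 2) := by
  have hx : 0 < x := by linarith
  have hy0 : 0 < y := by linarith
  have hmono := mul_one_div_one_add_exp_le hy hxy
  have hgap := one_div_one_add_exp_sub_lt hxy
  have hs0 : 0 < 1 / (1 + Real.exp x) := by positivity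
  have hst : 1 / (1 + Real.exp x) < 1 / (1 + Real.exp y) :=
    one_div_lt_one_div_of_lt (by positivity) (by linarith [Real.exp_lt_exp.2 hxy])
  rw [← mul_one_div τ (1 + Real.exp x), ← mul_one_div τ (1 + Real.exp y)]
  generalize 1 / (1 + Real.exp x) = s at *
  generalize 1 / (1 + Real.exp y) = t at *
  have ht0 : 0 < t := hs0.trans hst
  have hτs : 0 < τ * s := mul_pos hτ0 hs0
  have hτt : 0 < τ * t := mul_pos hτ0 ht0
  have hba : y + τ * t < x + τ * s := by nlinarith
  have hsq : (x + τ * s) ^ 2 - (y + τ * t) ^ 2 ≤ x ^ 2 - y ^ 2 := by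
    have h₁ : τ * (x * s) ≤ τ * (y * t) := mul_le_mul_of_nonneg_left hmono hτ0.le
    have h₂ : (τ * s) ^ 2 ≤ (τ * t) ^ 2 := by gcongr
    nlinarith
  refine ⟨sub_pos.2 (Real.sqrt_lt_sqrt (by positivity) ?_), ?_⟩
  · gcongr
  · exact sqrt_sq_add_sub_lt (sq_nonneg c) hy0 hx hba (by linarith) (by linarith) hsq
end

section
/- For every real τ with 0 < τ ≤ 1, every real constant c, and all reals x, y ≥ 3/2, writing g(t) = √((t + τ/(1+e^t))² + c²) and G(t) = √(t² + c²), we have (g(x) − g(y))² ≤ (G(x) − G(y))², with strict inequality whenever x ≠ y. -/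
/-- `t / (1 + exp t)` is strictly decreasing on `[3/2, ∞)`. -/
lemma div_one_add_exp_strictAntiOn :
    StrictAntiOn (fun t : ℝ => t / (1 + Real.exp t)) (Set.Ici (3 / 2)) := by
  intro y hy x _ hxy
  have hy' : 3 / 2 ≤ y := hy
  have hexp : Real.exp y * (1 + (x - y)) ≤ Real.exp x := by
    calc Real.exp y * (1 + (x - y)) ≤ Real.exp y * Real.exp (x - y) := by
          gcongr
          linarith [Real.add_one_le_exp (x - y)]
      _ = Real.exp x := by rw [← Real.exp_add]; ring_nf
  have hey : 1 + Real.exp y < y * Real.exp y := by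
    nlinarith [Real.add_one_le_exp y]
  change x / (1 + Real.exp x) < y / (1 + Real.exp y)
  rw [div_lt_div_iff₀ (by positivity) (by positivity)]
  nlinarith [mul_lt_mul_of_pos_left hey (sub_pos.2 hxy),
    mul_le_mul_of_nonneg_left hexp (by linarith : 0 ≤ y)]

/-- The function `1 / (1 + exp t)` decreases at rate at most one. -/
lemma one_div_one_add_exp_sub_le {x y : ℝ} (hxy : y ≤ x) :
    1 / (1 + Real.exp y) - 1 / (1 + Real.exp x) ≤ x - y := by
  have hexp : Real.exp x * (1 + (y - x)) ≤ Real.exp y := by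
    calc Real.exp x * (1 + (y - x)) ≤ Real.exp x * Real.exp (y - x) := by
          gcongr
          linarith [Real.add_one_le_exp (y - x)]
      _ = Real.exp y := by rw [← Real.exp_add]; ring_nf
  have hx := Real.exp_pos x
  have hy := Real.exp_pos y
  rw [div_sub_div _ _ (by positivity) (by positivity), div_le_iff₀ (by positivity)]
  have hnonneg : 0 ≤ (x - y) * (1 + Real.exp y + Real.exp x * Real.exp y) :=
    mul_nonneg (by linarith) (by positivity)
  nlinarith

/-- Enlarging two norms while shrinking the difference of their squares shrinks the difference of
the norms. -/
lemma sub_lt_sub_of_sq_sub_sq_lt {A B P Q : ℝ} (hP : 0 ≤ P) (hQ : 0 ≤ Q) (hPA : P ≤ A)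
    (hQB : Q ≤ B) (hBA : B ≤ A) (h : A ^ 2 - B ^ 2 < P ^ 2 - Q ^ 2) : A - B < P - Q := by
  by_contra! hle
  nlinarith [mul_nonneg (sub_nonneg.2 hBA) (by linarith : 0 ≤ A + B - (P + Q)),
    mul_nonneg (sub_nonneg.2 hle) (by linarith : 0 ≤ P + Q)]

lemma contrast_reg_sq_sub_lt (τ c : ℝ) {x y : ℝ} (hτ0 : 0 < τ) (hτ1 : τ ≤ 1)
    (hy : 3 / 2 ≤ y) (hxy : y < x) :
    (Real.sqrt ((x + τ / (1 + Real.exp x)) ^ 2 + c ^ 2)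
        - Real.sqrt ((y + τ / (1 + Real.exp y)) ^ 2 + c ^ 2)) ^ 2
      < (Real.sqrt (x ^ 2 + c ^ 2) - Real.sqrt (y ^ 2 + c ^ 2)) ^ 2 := by
  have hanti : x / (1 + Real.exp x) < y / (1 + Real.exp y) :=
    div_one_add_exp_strictAntiOn hy (by simp only [Set.mem_Ici]; linarith) hxy
  have hlip := one_div_one_add_exp_sub_le hxy.le
  have hsle : 1 / (1 + Real.exp x) ≤ 1 / (1 + Real.exp y) := by gcongr
  have hs0 : 0 < 1 / (1 + Real.exp x) := by positivity
  rw [div_eq_mul_one_div x, div_eq_mul_one_div y] at hanti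
  rw [div_eq_mul_one_div τ (1 + Real.exp x), div_eq_mul_one_div τ (1 + Real.exp y)]
  generalize 1 / (1 + Real.exp x) = s at *
  generalize 1 / (1 + Real.exp y) = r at *
  have hτs : 0 < τ * s := mul_pos hτ0 hs0
  have hτsr : τ * s ≤ τ * r := by gcongr
  have hmono : y + τ * r ≤ x + τ * s := by
    nlinarith [mul_nonneg (sub_nonneg.2 hτ1) (sub_nonneg.2 hsle)]
  have hBA : √((y + τ * r) ^ 2 + c ^ 2) ≤ √((x + τ * s) ^ 2 + c ^ 2) := by
    gcongr
    linarith
  refine pow_lt_pow_left₀ (sub_lt_sub_of_sq_sub_sq_lt (Real.sqrt_nonneg _) (Real.sqrt_nonneg _)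
    ?_ ?_ hBA ?_) (sub_nonneg.2 hBA) two_ne_zero
  · gcongr <;> linarith
  · gcongr
    linarith
  · rw [Real.sq_sqrt (by positivity), Real.sq_sqrt (by positivity), Real.sq_sqrt (by positivity),
      Real.sq_sqrt (by positivity)]
    nlinarith [mul_lt_mul_of_pos_left hanti hτ0, pow_le_pow_left₀ hτs.le hτsr 2]


/-- For every real τ with 0 < τ ≤ 1, every real constant c, and all reals x, y ≥ 3/2,
writing g(t) = √((t + τ/(1+e^t))² + c²) and G(t) = √(t² + c²), we have
(g(x) − g(y))² ≤ (G(x) − G(y))², with strict inequality whenever x ≠ y. -/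
theorem contrast_reg_squared_diff_contraction (τ c x y : ℝ) (hτ0 : 0 < τ) (hτ1 : τ ≤ 1)
    (hx : 3 / 2 ≤ x) (hy : 3 / 2 ≤ y) :
    (Real.sqrt ((x + τ / (1 + Real.exp x)) ^ 2 + c ^ 2)
        - Real.sqrt ((y + τ / (1 + Real.exp y)) ^ 2 + c ^ 2)) ^ 2
      ≤ (Real.sqrt (x ^ 2 + c ^ 2) - Real.sqrt (y ^ 2 + c ^ 2)) ^ 2 ∧
    (x ≠ y →
      (Real.sqrt ((x + τ / (1 + Real.exp x)) ^ 2 + c ^ 2)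
          - Real.sqrt ((y + τ / (1 + Real.exp y)) ^ 2 + c ^ 2)) ^ 2
        < (Real.sqrt (x ^ 2 + c ^ 2) - Real.sqrt (y ^ 2 + c ^ 2)) ^ 2) := by
  have hstrict : x ≠ y →
      (Real.sqrt ((x + τ / (1 + Real.exp x)) ^ 2 + c ^ 2)
          - Real.sqrt ((y + τ / (1 + Real.exp y)) ^ 2 + c ^ 2)) ^ 2
        < (Real.sqrt (x ^ 2 + c ^ 2) - Real.sqrt (y ^ 2 + c ^ 2)) ^ 2 := by
    intro hne
    rcases hne.lt_or_gt with hlt | hgt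
    · rw [sub_sq_comm, sub_sq_comm √(x ^ 2 + c ^ 2)]
      exact contrast_reg_sq_sub_lt τ c hτ0 hτ1 hx hlt
    · exact contrast_reg_sq_sub_lt τ c hτ0 hτ1 hy hgt
  refine ⟨?_, hstrict⟩
  rcases eq_or_ne x y with rfl | hne
  · simp
  · exact (hstrict hne).le
end

section
/- In the latent-class contrastive framework with one negative sample, the same-class NCE loss satisfies L_nce^=(f) ≤ 4·s(f) + 2·log 2. -/
open MeasureTheory ProbabilityTheory
open scoped RealInnerProductSpace

theorem Real.log_one_add_exp_le_add_sq (t : ℝ) {ε : ℝ} (hε : 0 < ε) :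
    Real.log (1 + Real.exp t) ≤ Real.log 2 + ε / 2 + t ^ 2 / (2 * ε) := by
  have h_abs : Real.log (1 + Real.exp t) ≤ Real.log 2 + |t| := by
    rw [← Real.log_exp |t|, ← Real.log_mul (by norm_num) (Real.exp_ne_zero _)]
    apply Real.log_le_log (by positivity)
    linarith [Real.exp_le_exp.mpr (le_abs_self t), Real.one_le_exp (abs_nonneg t)]
  have h_amgm : |t| ≤ ε / 2 + t ^ 2 / (2 * ε) := by
    have h_eq : ε / 2 + t ^ 2 / (2 * ε) - |t| = (ε - |t|) ^ 2 / (2 * ε) := by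
      rw [← sq_abs t]
      field_simp
      ring
    linarith [show 0 ≤ (ε - |t|) ^ 2 / (2 * ε) by positivity]
  linarith

theorem Real.log_one_add_exp_nonneg (t : ℝ) : 0 ≤ Real.log (1 + Real.exp t) :=
  Real.log_nonneg (by linarith [Real.exp_pos t])

theorem le_two_mul_sqrt_add_of_forall_pos {a b J : ℝ} (hJ : 0 ≤ J)
    (h : ∀ ε : ℝ, 0 < ε → a ≤ b + ε + J / ε) : a ≤ 2 * Real.sqrt J + b := by
  refine le_of_forall_pos_le_add fun δ hδ => ?_
  have h_sqrt := Real.sqrt_nonneg J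
  have h_div : J / (Real.sqrt J + δ) ≤ Real.sqrt J := by
    rw [div_le_iff₀ (by positivity)]
    nlinarith [Real.mul_self_sqrt hJ]
  linarith [h (Real.sqrt J + δ) (by positivity)]

/-- Integrating an affine upper bound of a nonnegative function, whose measurability is not
needed. -/
theorem integral_le_add_integral_div {Y : Type*} [MeasurableSpace Y] (μ : Measure Y)
    [IsProbabilityMeasure μ] {u v : Y → ℝ} {a b : ℝ} (hu : ∀ y, 0 ≤ u y) (hv : Integrable v μ)
    (huv : ∀ y, u y ≤ a + v y / b) : ∫ y, u y ∂μ ≤ a + (∫ y, v y ∂μ) / b := by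
  calc ∫ y, u y ∂μ ≤ ∫ y, (a + v y / b) ∂μ :=
        integral_mono_of_nonneg (ae_of_all _ hu) ((integrable_const a).add (hv.div_const b))
          (ae_of_all _ huv)
    _ = a + (∫ y, v y ∂μ) / b := by
        rw [integral_add (integrable_const a) (hv.div_const b), integral_div]
        simp

/-- A binary logistic loss on scores `G x xp` and `G x xn` of i.i.d. samples is controlled by the
second moment of the score. -/
theorem integral_logistic_pair_le
    {C : Type*} [MeasurableSpace C] (ρ : Measure C) [IsProbabilityMeasure ρ]
    {X : Type*} [MeasurableSpace X] (κ : Kernel C X) [IsMarkovKernel κ]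
    (G : X → X → ℝ) (hG : Measurable (Function.uncurry G))
    {B : ℝ} (hB : ∀ x y, |G x y| ≤ B) {ε : ℝ} (hε : 0 < ε) :
    ∫ c, (∫ x, (∫ xp, (∫ xn, (Real.log (1 + Real.exp (-G x xp)) +
      Real.log (1 + Real.exp (G x xn))) ∂(κ c)) ∂(κ c)) ∂(κ c)) ∂ρ ≤
    2 * Real.log 2 + ε + (∫ c, (∫ x, (∫ y, G x y ^ 2 ∂(κ c)) ∂(κ c)) ∂ρ) / ε := by
  have h_sq_le (x y : X) : G x y ^ 2 ≤ B ^ 2 :=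
    sq_le_sq' (abs_le.mp (hB x y)).1 (abs_le.mp (hB x y)).2
  have h_sq_meas : StronglyMeasurable (Function.uncurry fun x y => G x y ^ 2) :=
    (hG.pow_const 2).stronglyMeasurable
  have h_int (c : C) (x : X) : Integrable (fun y => G x y ^ 2) (κ c) :=
    Integrable.of_bound (h_sq_meas.comp_measurable measurable_prodMk_left).aestronglyMeasurable
      (B ^ 2) (ae_of_all _ fun y => by simpa using h_sq_le x y)
  have h_inner_le (c : C) (x : X) : ∫ y, G x y ^ 2 ∂(κ c) ≤ B ^ 2 := by
    simpa using integral_mono (h_int c x) (integrable_const (B ^ 2)) (h_sq_le x)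
  have h_inner_nonneg (c : C) (x : X) : 0 ≤ ∫ y, G x y ^ 2 ∂(κ c) :=
    integral_nonneg fun y => sq_nonneg _
  have h_int_inner (c : C) : Integrable (fun x => ∫ y, G x y ^ 2 ∂(κ c)) (κ c) :=
    Integrable.of_bound h_sq_meas.integral_prod_right.aestronglyMeasurable (B ^ 2)
      (ae_of_all _ fun x => by
        simpa [abs_of_nonneg (h_inner_nonneg c x)] using h_inner_le c x)
  have h_outer_nonneg (c : C) : 0 ≤ ∫ x, ∫ y, G x y ^ 2 ∂(κ c) ∂(κ c) :=
    integral_nonneg fun x => h_inner_nonneg c x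
  have h_outer_le (c : C) : ∫ x, ∫ y, G x y ^ 2 ∂(κ c) ∂(κ c) ≤ B ^ 2 := by
    simpa using integral_mono (h_int_inner c) (integrable_const (B ^ 2)) (h_inner_le c)
  have h_outer_meas : StronglyMeasurable fun c => ∫ x, ∫ y, G x y ^ 2 ∂(κ c) ∂(κ c) := by
    have h_prod (c : C) : ∫ x, ∫ y, G x y ^ 2 ∂(κ c) ∂(κ c) =
        ∫ z, Function.uncurry (fun x y => G x y ^ 2) z ∂((κ ×ₖ κ) c) := by
      rw [Kernel.prod_apply, integral_prod]
      · rfl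
      · exact Integrable.of_bound h_sq_meas.aestronglyMeasurable (B ^ 2)
          (ae_of_all _ fun z => by simpa [Function.uncurry] using h_sq_le z.1 z.2)
    simp_rw [h_prod]
    exact h_sq_meas.integral_kernel
  have h_int_outer : Integrable (fun c => ∫ x, ∫ y, G x y ^ 2 ∂(κ c) ∂(κ c)) ρ :=
    Integrable.of_bound h_outer_meas.aestronglyMeasurable (B ^ 2)
      (ae_of_all _ fun c => by
        simpa [abs_of_nonneg (h_outer_nonneg c)] using h_outer_le c)
  have h_nonneg (x xp xn : X) : 0 ≤ Real.log (1 + Real.exp (-G x xp)) +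
      Real.log (1 + Real.exp (G x xn)) :=
    add_nonneg (Real.log_one_add_exp_nonneg _) (Real.log_one_add_exp_nonneg _)
  refine integral_le_add_integral_div ρ (fun c => integral_nonneg fun x => integral_nonneg fun xp =>
    integral_nonneg fun xn => h_nonneg x xp xn) h_int_outer fun c => ?_
  refine integral_le_add_integral_div (κ c) (fun x => integral_nonneg fun xp =>
    integral_nonneg fun xn => h_nonneg x xp xn) (h_int_inner c) fun x => ?_
  calc _ ≤ (2 * Real.log 2 + ε + (∫ y, G x y ^ 2 ∂(κ c)) / (2 * ε)) +
        (∫ y, G x y ^ 2 ∂(κ c)) / (2 * ε) := by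
        refine integral_le_add_integral_div (κ c)
          (fun xp => integral_nonneg fun xn => h_nonneg x xp xn) (h_int c x) fun xp => ?_
        rw [add_right_comm]
        refine integral_le_add_integral_div (κ c) (fun xn => h_nonneg x xp xn) (h_int c x)
          fun xn => ?_
        have h_pos := Real.log_one_add_exp_le_add_sq (-G x xp) hε
        have h_neg := Real.log_one_add_exp_le_add_sq (G x xn) hε
        rw [neg_sq] at h_pos
        linarith
    _ = _ := by
        field_simp
        ring

/-- Lemma 3 of the paper (class collision). In the latent-class contrastive framework
with one negative sample, the same-class NCE loss, in which anchor, positive and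
negative samples are drawn i.i.d. from the same class, satisfies
L_nce^=(f) ≤ 4·s(f) + 2·log 2, where
s(f) = 4·√(E_{c∼ρ} E_{x,x'∼D_c} ⟪f(x), f(x')⟫²). -/
theorem nce_class_collision_bound
    {C : Type*} [MeasurableSpace C] (ρ : Measure C) [IsProbabilityMeasure ρ]
    {X : Type*} [MeasurableSpace X] (κ : Kernel C X) [IsMarkovKernel κ]
    {d : ℕ} (f : X → EuclideanSpace ℝ (Fin d)) (hf : Measurable f)
    (R : ℝ) (hR : 0 < R) (hfR : ∀ x, ‖f x‖ ≤ R)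
    (LnceEq : ℝ)
    (hLnceEq : LnceEq =
      ∫ c, (∫ x, (∫ xp, (∫ xn,
          (Real.log (1 + Real.exp (-⟪f x, f xp⟫)) +
           Real.log (1 + Real.exp ⟪f x, f xn⟫)) ∂(κ c)) ∂(κ c)) ∂(κ c)) ∂ρ)
    (s : ℝ)
    (hs : s = 4 * Real.sqrt
      (∫ c, (∫ x, (∫ x', (⟪f x, f x'⟫ : ℝ) ^ 2 ∂(κ c)) ∂(κ c)) ∂ρ)) :
    LnceEq ≤ 4 * s + 2 * Real.log 2 := by
  subst hLnceEq hs
  have h_meas : Measurable (Function.uncurry fun x y => (⟪f x, f y⟫ : ℝ)) :=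
    (hf.comp measurable_fst).inner (hf.comp measurable_snd)
  have h_bound (x y : X) : |(⟪f x, f y⟫ : ℝ)| ≤ R * R :=
    (abs_real_inner_le_norm _ _).trans
      (mul_le_mul (hfR x) (hfR y) (norm_nonneg _) hR.le)
  have h_moment_nonneg : 0 ≤ ∫ c, (∫ x, (∫ x', (⟪f x, f x'⟫ : ℝ) ^ 2 ∂(κ c)) ∂(κ c)) ∂ρ :=
    integral_nonneg fun c => integral_nonneg fun x => integral_nonneg fun y => sq_nonneg _
  have h_main := le_two_mul_sqrt_add_of_forall_pos h_moment_nonneg fun ε hε =>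
    integral_logistic_pair_le ρ κ (fun x y => ⟪f x, f y⟫) h_meas h_bound hε
  linarith [Real.sqrt_nonneg
    (∫ c, (∫ x, (∫ x', (⟪f x, f x'⟫ : ℝ) ^ 2 ∂(κ c)) ∂(κ c)) ∂ρ)]
end

section
/- In the latent-class contrastive framework with one negative sample, if τ < 1 then L_sup^μ(f) ≤ L_nce^≠(f) + β·s(f) + α, where β = τ/(1−τ) and α = (1/(1−τ))·(2·log 2 − 1). -/
open MeasureTheory ProbabilityTheory
open scoped RealInnerProductSpace

theorem Real.convexOn_log_one_add_exp :
    ConvexOn ℝ Set.univ fun t : ℝ => Real.log (1 + Real.exp t) := by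
  have hderiv (t : ℝ) :
      HasDerivAt (fun t : ℝ => Real.log (1 + Real.exp t)) (Real.sigmoid t) t := by
    have h := ((Real.hasDerivAt_exp t).const_add 1).log (by positivity)
    convert h using 1
    rw [Real.sigmoid_def, Real.exp_neg]
    have := Real.exp_pos t
    field_simp
    ring
  refine Monotone.convexOn_univ_of_deriv (fun t => (hderiv t).differentiableAt) ?_
  rw [show deriv (fun t : ℝ => Real.log (1 + Real.exp t)) = Real.sigmoid from
    funext fun t => (hderiv t).deriv]
  exact Real.sigmoid_monotone

theorem Real.continuous_log_one_add_exp :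
    Continuous fun t : ℝ => Real.log (1 + Real.exp t) :=
  Continuous.log (by fun_prop) fun t => by positivity

theorem Real.log_one_add_exp_le {t B : ℝ} (h : t ≤ B) :
    Real.log (1 + Real.exp t) ≤ Real.log (1 + Real.exp B) :=
  Real.log_le_log (by positivity) (by gcongr)

theorem integrable_of_measurable_of_mem_Icc {Ω : Type*} [MeasurableSpace Ω] (ν : Measure Ω)
    [IsFiniteMeasure ν] {g : Ω → ℝ} (hg : StronglyMeasurable g) {a b : ℝ}
    (h : ∀ x, g x ∈ Set.Icc a b) : Integrable g ν :=
  Integrable.of_mem_Icc a b hg.measurable.aemeasurable (ae_of_all _ h)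

theorem integral_mem_Icc_of_forall {Ω : Type*} [MeasurableSpace Ω] (ν : Measure Ω)
    [IsProbabilityMeasure ν] {g : Ω → ℝ} (hg : StronglyMeasurable g) {a b : ℝ}
    (h : ∀ x, g x ∈ Set.Icc a b) : ∫ x, g x ∂ν ∈ Set.Icc a b := by
  have hi := integrable_of_measurable_of_mem_Icc ν hg h
  constructor
  · simpa using integral_mono (integrable_const a) hi fun x => (h x).1
  · simpa using integral_mono hi (integrable_const b) fun x => (h x).2

/-- Jensen's inequality for the logistic loss. -/
theorem log_one_add_exp_integral_le {Ω : Type*} [MeasurableSpace Ω] (ν : Measure Ω)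
    [IsProbabilityMeasure ν] {h : Ω → ℝ} (hh : StronglyMeasurable h) {B : ℝ}
    (hB : ∀ x, |h x| ≤ B) :
    Real.log (1 + Real.exp (∫ x, h x ∂ν)) ≤ ∫ x, Real.log (1 + Real.exp (h x)) ∂ν := by
  refine Real.convexOn_log_one_add_exp.map_integral_le
    Real.continuous_log_one_add_exp.continuousOn isClosed_univ (by simp)
    (integrable_of_measurable_of_mem_Icc ν hh fun x => abs_le.mp (hB x))
    (integrable_of_measurable_of_mem_Icc ν
      (Real.continuous_log_one_add_exp.comp_stronglyMeasurable hh) fun x =>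
        ⟨Real.log_one_add_exp_nonneg _,
          Real.log_one_add_exp_le ((le_abs_self _).trans (hB x))⟩)

section MeanClassifier

variable {X : Type*} {E : Type*} [NormedAddCommGroup E] [InnerProductSpace ℝ E]
  {f : X → E} {R : ℝ}

/-- The pair loss `log (1 + exp (-⟪f x, f x⁺⟫)) + log (1 + exp ⟪f x, f x⁻⟫)`. -/
noncomputable def nceLoss (f : X → E) (x xp xn : X) : ℝ :=
  Real.log (1 + Real.exp (-⟪f x, f xp⟫)) + Real.log (1 + Real.exp ⟪f x, f xn⟫)

theorem abs_inner_le_sq (hfR : ∀ x, ‖f x‖ ≤ R) (x y : X) : |⟪f x, f y⟫| ≤ R ^ 2 :=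
  (abs_real_inner_le_norm _ _).trans <| by
    rw [sq]
    exact mul_le_mul (hfR x) (hfR y) (norm_nonneg _) ((norm_nonneg _).trans (hfR x))

theorem nceLoss_mem_Icc (hfR : ∀ x, ‖f x‖ ≤ R) (x xp xn : X) :
    nceLoss f x xp xn ∈ Set.Icc 0 (2 * Real.log (1 + Real.exp (R ^ 2))) := by
  have h₁ := Real.log_one_add_exp_le ((neg_le_abs _).trans (abs_inner_le_sq hfR x xp))
  have h₂ := Real.log_one_add_exp_le ((le_abs_self _).trans (abs_inner_le_sq hfR x xn))
  have h₃ := Real.log_one_add_exp_nonneg (-⟪f x, f xp⟫)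
  have h₄ := Real.log_one_add_exp_nonneg ⟪f x, f xn⟫
  unfold nceLoss
  constructor <;> linarith

variable {C : Type*} [MeasurableSpace C] [MeasurableSpace X] (κ : Kernel C X) [IsMarkovKernel κ]
  [SecondCountableTopology E] [MeasurableSpace E] [BorelSpace E]

theorem stronglyMeasurable_nceLoss (hf : Measurable f) :
    StronglyMeasurable fun q : (X × X) × X => nceLoss f q.1.1 q.1.2 q.2 := by
  unfold nceLoss
  exact Measurable.stronglyMeasurable (by fun_prop)

theorem stronglyMeasurable_integral_nceLoss (hf : Measurable f) :
    StronglyMeasurable fun q : ((C × C) × X) × X =>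
      ∫ xn, nceLoss f q.1.2 q.2 xn ∂(κ q.1.1.2) := by
  have h : StronglyMeasurable fun q : (((C × C) × X) × X) × X =>
      nceLoss f q.1.1.2 q.1.2 q.2 :=
    (stronglyMeasurable_nceLoss hf).comp_measurable (g := fun q : (((C × C) × X) × X) × X =>
      ((q.1.1.2, q.1.2), q.2)) (by fun_prop)
  exact h.integral_kernel_prod_right'
    (κ := κ.comap (fun q : ((C × C) × X) × X => q.1.1.2) (by fun_prop))

theorem stronglyMeasurable_integral_integral_nceLoss (hf : Measurable f) :
    StronglyMeasurable fun q : (C × C) × X =>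
      ∫ xp, ∫ xn, nceLoss f q.2 xp xn ∂(κ q.1.2) ∂(κ q.1.1) :=
  (stronglyMeasurable_integral_nceLoss κ hf).integral_kernel_prod_right'
    (κ := κ.comap (fun q : (C × C) × X => q.1.1) (by fun_prop))

theorem stronglyMeasurable_integral_integral_integral_nceLoss (hf : Measurable f) :
    StronglyMeasurable fun p : C × C =>
      ∫ x, ∫ xp, ∫ xn, nceLoss f x xp xn ∂(κ p.2) ∂(κ p.1) ∂(κ p.1) :=
  (stronglyMeasurable_integral_integral_nceLoss κ hf).integral_kernel_prod_right'
    (κ := κ.comap (fun p : C × C => p.1) (by fun_prop))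

theorem integral_nceLoss_mem_Icc (hf : Measurable f) (hfR : ∀ x, ‖f x‖ ≤ R) (c : C) (x xp : X) :
    ∫ xn, nceLoss f x xp xn ∂(κ c) ∈ Set.Icc 0 (2 * Real.log (1 + Real.exp (R ^ 2))) :=
  integral_mem_Icc_of_forall _
    ((stronglyMeasurable_nceLoss hf).comp_measurable (g := fun xn => ((x, xp), xn))
      (by fun_prop)) fun xn => nceLoss_mem_Icc hfR x xp xn

theorem integral_integral_nceLoss_mem_Icc (hf : Measurable f) (hfR : ∀ x, ‖f x‖ ≤ R)
    (p : C × C) (x : X) :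
    ∫ xp, ∫ xn, nceLoss f x xp xn ∂(κ p.2) ∂(κ p.1) ∈
      Set.Icc 0 (2 * Real.log (1 + Real.exp (R ^ 2))) :=
  integral_mem_Icc_of_forall _
    ((stronglyMeasurable_integral_nceLoss κ hf).comp_measurable
      (g := fun xp => ((p, x), xp)) (by fun_prop)) fun xp =>
    integral_nceLoss_mem_Icc κ hf hfR p.2 x xp

/-- Replacing the positive and negative samples by their class means does not increase the
expected pair loss. -/
theorem log_add_log_mean_le_integral_nceLoss [CompleteSpace E] (hf : Measurable f)
    (hfR : ∀ x, ‖f x‖ ≤ R) (p : C × C) (x : X) :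
    Real.log (1 + Real.exp (-⟪f x, ∫ y, f y ∂(κ p.1)⟫)) +
        Real.log (1 + Real.exp ⟪f x, ∫ y, f y ∂(κ p.2)⟫) ≤
      ∫ xp, ∫ xn, nceLoss f x xp xn ∂(κ p.2) ∂(κ p.1) := by
  have hint (c : C) : Integrable f (κ c) :=
    .of_bound hf.aestronglyMeasurable R (ae_of_all _ hfR)
  have hinner : StronglyMeasurable fun y => ⟪f x, f y⟫ :=
    Measurable.stronglyMeasurable (by fun_prop)
  have habs := abs_inner_le_sq hfR x
  have hpos := log_one_add_exp_integral_le (κ p.1) hinner.neg (B := R ^ 2) fun y => by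
    simpa using habs y
  have hneg := log_one_add_exp_integral_le (κ p.2) hinner habs
  simp only [Pi.neg_apply] at hpos
  rw [integral_neg, integral_inner (hint _)] at hpos
  rw [integral_inner (hint _)] at hneg
  have hipos : Integrable (fun y => Real.log (1 + Real.exp (-⟪f x, f y⟫))) (κ p.1) :=
    integrable_of_measurable_of_mem_Icc _
      (Real.continuous_log_one_add_exp.comp_stronglyMeasurable hinner.neg) fun y =>
        ⟨Real.log_one_add_exp_nonneg _,
          Real.log_one_add_exp_le ((neg_le_abs _).trans (habs y))⟩
  have hineg : Integrable (fun y => Real.log (1 + Real.exp ⟪f x, f y⟫)) (κ p.2) :=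
    integrable_of_measurable_of_mem_Icc _
      (Real.continuous_log_one_add_exp.comp_stronglyMeasurable hinner) fun y =>
        ⟨Real.log_one_add_exp_nonneg _,
          Real.log_one_add_exp_le ((le_abs_self _).trans (habs y))⟩
  have hsplit : ∫ xp, ∫ xn, nceLoss f x xp xn ∂(κ p.2) ∂(κ p.1) =
      ∫ y, Real.log (1 + Real.exp (-⟪f x, f y⟫)) ∂(κ p.1) +
        ∫ y, Real.log (1 + Real.exp ⟪f x, f y⟫) ∂(κ p.2) := by
    have hin (xp : X) : ∫ xn, nceLoss f x xp xn ∂(κ p.2) =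
        Real.log (1 + Real.exp (-⟪f x, f xp⟫)) +
          ∫ y, Real.log (1 + Real.exp ⟪f x, f y⟫) ∂(κ p.2) := by
      unfold nceLoss
      rw [integral_add (integrable_const _) hineg]
      simp
    simp_rw [hin]
    rw [integral_add hipos (integrable_const _)]
    simp
  rw [hsplit]
  exact add_le_add hpos hneg

/-- On any set of class pairs, the supervised mean-classifier loss is at most the NCE loss. -/
theorem setIntegral_mean_loss_le_setIntegral_nceLoss [CompleteSpace E] (ν : Measure (C × C))
    [IsFiniteMeasure ν] (hf : Measurable f) (hfR : ∀ x, ‖f x‖ ≤ R) (S : Set (C × C)) :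
    ∫ p in S, (∫ x, (Real.log (1 + Real.exp (-⟪f x, ∫ y, f y ∂(κ p.1)⟫)) +
        Real.log (1 + Real.exp ⟪f x, ∫ y, f y ∂(κ p.2)⟫)) ∂(κ p.1)) ∂ν ≤
      ∫ p in S, (∫ x, ∫ xp, ∫ xn, nceLoss f x xp xn ∂(κ p.2) ∂(κ p.1) ∂(κ p.1)) ∂ν := by
  have hnonneg (p : C × C) (x : X) :
      0 ≤ Real.log (1 + Real.exp (-⟪f x, ∫ y, f y ∂(κ p.1)⟫)) +
        Real.log (1 + Real.exp ⟪f x, ∫ y, f y ∂(κ p.2)⟫) :=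
    add_nonneg (Real.log_one_add_exp_nonneg _) (Real.log_one_add_exp_nonneg _)
  have hmeas (p : C × C) :
      StronglyMeasurable fun x => ∫ xp, ∫ xn, nceLoss f x xp xn ∂(κ p.2) ∂(κ p.1) :=
    (stronglyMeasurable_integral_integral_nceLoss κ hf).comp_measurable
      (g := fun x => (p, x)) (by fun_prop)
  refine integral_mono_of_nonneg (ae_of_all _ fun p => integral_nonneg (hnonneg p))
    (integrable_of_measurable_of_mem_Icc _
      (stronglyMeasurable_integral_integral_integral_nceLoss κ hf) fun p =>
        integral_mem_Icc_of_forall _ (hmeas p) (integral_integral_nceLoss_mem_Icc κ hf hfR p))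
    (ae_of_all _ fun p => ?_)
  exact integral_mono_of_nonneg (ae_of_all _ (hnonneg p))
    (integrable_of_measurable_of_mem_Icc _ (hmeas p)
      (integral_integral_nceLoss_mem_Icc κ hf hfR p))
    (ae_of_all _ (log_add_log_mean_le_integral_nceLoss κ hf hfR p))

end MeanClassifier

/-- The in-expectation content of Theorem 1 of the paper. In the latent-class
contrastive framework with one negative sample, if the class-collision probability
τ < 1, then L_sup^μ(f) ≤ L_nce^≠(f) + β·s(f) + α, where β = τ/(1−τ) and
α = (1/(1−τ))·(2·log 2 − 1). -/
theorem nce_generalization_bound_in_expectation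
    {C : Type*} [MeasurableSpace C] (ρ : Measure C) [IsProbabilityMeasure ρ]
    {X : Type*} [MeasurableSpace X] (κ : Kernel C X) [IsMarkovKernel κ]
    {d : ℕ} (f : X → EuclideanSpace ℝ (Fin d)) (hf : Measurable f)
    (R : ℝ) (hR : 0 < R) (hfR : ∀ x, ‖f x‖ ≤ R)
    (τ : ℝ) (hτ : τ = ((ρ.prod ρ) {p : C × C | p.1 = p.2}).toReal) (hτ1 : τ < 1)
    (μ : C → EuclideanSpace ℝ (Fin d)) (hμ : ∀ c, μ c = ∫ x, f x ∂(κ c))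
    (Lsup : ℝ)
    (hLsup : Lsup = (1 / (1 - τ)) *
      ∫ p in {p : C × C | p.1 ≠ p.2},
        (∫ x, (Real.log (1 + Real.exp (-⟪f x, μ p.1⟫)) +
               Real.log (1 + Real.exp ⟪f x, μ p.2⟫)) ∂(κ p.1)) ∂(ρ.prod ρ))
    (LnceNe : ℝ)
    (hLnceNe : LnceNe = (1 / (1 - τ)) *
      ∫ p in {p : C × C | p.1 ≠ p.2},
        (∫ x, (∫ xp, (∫ xn,
            (Real.log (1 + Real.exp (-⟪f x, f xp⟫)) +
             Real.log (1 + Real.exp ⟪f x, f xn⟫)) ∂(κ p.2)) ∂(κ p.1)) ∂(κ p.1))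
        ∂(ρ.prod ρ))
    (s : ℝ)
    (hs : s = 4 * Real.sqrt
      (∫ c, (∫ x, (∫ x', (⟪f x, f x'⟫ : ℝ) ^ 2 ∂(κ c)) ∂(κ c)) ∂ρ)) :
    Lsup ≤ LnceNe + (τ / (1 - τ)) * s + (1 / (1 - τ)) * (2 * Real.log 2 - 1) := by
  have hτ0 : 0 ≤ τ := hτ ▸ ENNReal.toReal_nonneg
  have h1τ : 0 < 1 - τ := by linarith
  have hs0 : 0 ≤ s := hs ▸ by positivity
  have hα : 0 ≤ 1 / (1 - τ) * (2 * Real.log 2 - 1) :=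
    mul_nonneg (by positivity) (by linarith [Real.log_two_gt_d9])
  have hβ : 0 ≤ τ / (1 - τ) * s := by positivity
  have hmain : Lsup ≤ LnceNe := by
    rw [hLsup, hLnceNe]
    simp_rw [hμ]
    exact mul_le_mul_of_nonneg_left
      (setIntegral_mean_loss_le_setIntegral_nceLoss κ (ρ.prod ρ) hf hfR _) (by positivity)
  linarith
end
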